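/- arXiv:math/0507318 — 2 statements merged into one kernel-verified Lean document; each statement's English description precedes it below -/
import Mathlib

section
/- Let n ≥ 2 be an integer, let Ω ⊆ ℝⁿ be an open set, let X : Ω → ℝⁿ be a C¹ vector field, and let φ : ℝⁿ → ℝ be a smooth function with compact support contained in Ω. Then ∫_Ω φ(x)² div X(x) dx ≤ ∫_Ω ‖∇φ(x)‖² dx + ∫_Ω φ(x)² ‖X(x)‖² dx. -/
open scoped ENNReal Topology
open MeasureTheory

/-- The fundamental tone `λ*(Ω)` of an open set `Ω ⊆ ℝⁿ`: the infimum of the Rayleigh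
quotients `∫_Ω ‖∇φ‖² / ∫_Ω φ²` over all smooth functions `φ : ℝⁿ → ℝ`, not identically
zero, with compact support contained in `Ω` (valued in `ℝ≥0∞`; it is `∞` if no such `φ`
exists). -/
noncomputable def lamStar (n : ℕ) (Ω : Set (EuclideanSpace ℝ (Fin n))) : ℝ≥0∞ :=
  ⨅ φ : {φ : EuclideanSpace ℝ (Fin n) → ℝ //
      ContDiff ℝ (⊤ : ℕ∞) φ ∧ HasCompactSupport φ ∧ tsupport φ ⊆ Ω ∧ φ ≠ 0},
    ENNReal.ofReal ((∫ x in Ω, ‖gradient φ.1 x‖ ^ 2) / ∫ x in Ω, φ.1 x ^ 2)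

/-- The divergence of a vector field `X : ℝⁿ → ℝⁿ` at `x`: the trace of its derivative. -/
noncomputable def ediv {n : ℕ} (X : EuclideanSpace ℝ (Fin n) → EuclideanSpace ℝ (Fin n))
    (x : EuclideanSpace ℝ (Fin n)) : ℝ :=
  LinearMap.trace ℝ _ (fderiv ℝ X x).toLinearMap

/-- The Laplacian of `f : ℝⁿ → ℝ` at `x`: the trace of its Hessian, i.e. the divergence
of its gradient. -/
noncomputable def lap {n : ℕ} (f : EuclideanSpace ℝ (Fin n) → ℝ)
    (x : EuclideanSpace ℝ (Fin n)) : ℝ :=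
  LinearMap.trace ℝ _ (fderiv ℝ (gradient f) x).toLinearMap

/-- The divergence as a sum of directional derivatives along the standard basis. -/
lemma ediv_eq_sum_inner {n : ℕ} (X : EuclideanSpace ℝ (Fin n) → EuclideanSpace ℝ (Fin n))
    (x : EuclideanSpace ℝ (Fin n)) :
    ediv X x = ∑ i, inner ℝ (EuclideanSpace.basisFun (Fin n) ℝ i)
      (fderiv ℝ X x (EuclideanSpace.basisFun (Fin n) ℝ i)) :=
  LinearMap.trace_eq_sum_inner _ (EuclideanSpace.basisFun (Fin n) ℝ)

/-- The divergence of a `C¹` vector field on an open set is continuous there. -/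
lemma ContDiffOn.continuousOn_ediv {n : ℕ} {Ω : Set (EuclideanSpace ℝ (Fin n))}
    {X : EuclideanSpace ℝ (Fin n) → EuclideanSpace ℝ (Fin n)} (hX : ContDiffOn ℝ 1 X Ω)
    (hΩ : IsOpen Ω) : ContinuousOn (ediv X) Ω := by
  have h := hX.continuousOn_fderiv_of_isOpen hΩ le_rfl
  simp only [funext (ediv_eq_sum_inner X)]
  fun_prop

/-- The product rule for the divergence. -/
lemma ediv_smul {n : ℕ} {f : EuclideanSpace ℝ (Fin n) → ℝ}
    {X : EuclideanSpace ℝ (Fin n) → EuclideanSpace ℝ (Fin n)} {x : EuclideanSpace ℝ (Fin n)}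
    (hf : DifferentiableAt ℝ f x) (hX : DifferentiableAt ℝ X x) :
    ediv (fun y ↦ f y • X y) x = f x * ediv X x + fderiv ℝ f x (X x) := by
  unfold ediv
  rw [fderiv_fun_smul hf hX]
  simp [LinearMap.trace_smulRight]

/-- The divergence of a compactly supported `C¹` vector field is integrable. -/
lemma ContDiff.integrable_ediv {n : ℕ}
    {Y : EuclideanSpace ℝ (Fin n) → EuclideanSpace ℝ (Fin n)} (hY : ContDiff ℝ 1 Y)
    (hc : HasCompactSupport Y) : Integrable (ediv Y) := by
  refine Continuous.integrable_of_hasCompactSupport ?_ ?_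
  · exact continuousOn_univ.1 (hY.contDiffOn.continuousOn_ediv isOpen_univ)
  · exact (hc.fderiv (𝕜 := ℝ)).mono fun x hx h0 ↦ hx (by simp [ediv, h0])

/-- The divergence of a compactly supported `C¹` vector field has integral zero. -/
lemma ContDiff.integral_ediv_eq_zero {n : ℕ}
    {Y : EuclideanSpace ℝ (Fin n) → EuclideanSpace ℝ (Fin n)} (hY : ContDiff ℝ 1 Y)
    (hc : HasCompactSupport Y) : ∫ x, ediv Y x = 0 := by
  have hfd : Continuous (fderiv ℝ Y) := hY.continuous_fderiv one_ne_zero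
  have hint (v : EuclideanSpace ℝ (Fin n)) : Integrable fun x ↦ fderiv ℝ Y x v :=
    (hfd.clm_apply continuous_const).integrable_of_hasCompactSupport (hc.fderiv_apply ℝ v)
  have hzero (v : EuclideanSpace ℝ (Fin n)) : ∫ x, fderiv ℝ Y x v = 0 := by
    simpa using integral_smul_fderiv_eq_neg_fderiv_smul_of_integrable (μ := volume) (𝕜 := ℝ)
      (f := fun _ ↦ (1 : ℝ)) (g := Y) (v := v) (by simp) (by simpa using hint v)
      (by simpa using hY.continuous.integrable_of_hasCompactSupport hc)
      (fun _ _ ↦ differentiableAt_const _) (fun x _ ↦ hY.differentiable one_ne_zero x)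
  simp only [ediv_eq_sum_inner]
  rw [integral_finsetSum _ fun i _ ↦ (hint _).const_inner _]
  refine Finset.sum_eq_zero fun i _ ↦ ?_
  rw [integral_inner (hint _), hzero, inner_zero_right]

/-- A continuous function with compact support in an open set, multiplied by a function
continuous on that set, is integrable. -/
lemma HasCompactSupport.integrable_mul_of_continuousOn {n : ℕ}
    {Ω : Set (EuclideanSpace ℝ (Fin n))} {f g : EuclideanSpace ℝ (Fin n) → ℝ} (hΩ : IsOpen Ω)
    (hfc : HasCompactSupport f) (hfΩ : tsupport f ⊆ Ω) (hf : Continuous f)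
    (hg : ContinuousOn g Ω) : Integrable fun x ↦ f x * g x := by
  refine Continuous.integrable_of_hasCompactSupport ?_ hfc.mul_right
  refine continuous_of_tsupport fun x hx ↦ ?_
  have hxΩ : x ∈ Ω := hfΩ (tsupport_mul_subset_left hx)
  exact hf.continuousAt.mul (hg.continuousAt (hΩ.mem_nhds hxΩ))

/-- key step in the proof of Theorem 2.3: for a `C¹` vector field `X` on the
open set `Ω ⊆ ℝⁿ` and a smooth `φ` with compact support in `Ω`,
`∫_Ω φ² div X ≤ ∫_Ω ‖∇φ‖² + ∫_Ω φ² ‖X‖²`. -/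
theorem stmt1 (n : ℕ) (hn : 2 ≤ n) (Ω : Set (EuclideanSpace ℝ (Fin n))) (hΩ : IsOpen Ω)
    (X : EuclideanSpace ℝ (Fin n) → EuclideanSpace ℝ (Fin n)) (hX : ContDiffOn ℝ 1 X Ω)
    (φ : EuclideanSpace ℝ (Fin n) → ℝ) (hφ : ContDiff ℝ (⊤ : ℕ∞) φ) (hφc : HasCompactSupport φ)
    (hφΩ : tsupport φ ⊆ Ω) :
    ∫ x in Ω, φ x ^ 2 * ediv X x ≤
      (∫ x in Ω, ‖gradient φ x‖ ^ 2) + ∫ x in Ω, φ x ^ 2 * ‖X x‖ ^ 2 := by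
  have hsq : ContDiff ℝ 1 fun x ↦ φ x ^ 2 := (hφ.of_le (by norm_cast)).pow 2
  have hφd : Differentiable ℝ φ := hφ.differentiable (by simp)
  have hsqs : tsupport (fun x ↦ φ x ^ 2) ⊆ tsupport φ :=
    closure_mono fun x hx h0 ↦ hx (by simp [h0])
  have hsqc : HasCompactSupport fun x ↦ φ x ^ 2 := hφc.of_isClosed_subset isClosed_closure hsqs
  have hXat {x} (hx : x ∈ Ω) : ContDiffAt ℝ 1 X x := hX.contDiffAt (hΩ.mem_nhds hx)
  have hY : ContDiff ℝ 1 fun x ↦ φ x ^ 2 • X x := contDiff_iff_contDiffAt.2 fun x ↦ by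
    by_cases hx : x ∈ tsupport fun x ↦ φ x ^ 2 • X x
    · exact hsq.contDiffAt.smul (hXat (hφΩ (hsqs (tsupport_smul_subset_left _ _ hx))))
    · exact contDiffAt_const.congr_of_eventuallyEq (notMem_tsupport_iff_eventuallyEq.1 hx)
  have hYc : HasCompactSupport fun x ↦ φ x ^ 2 • X x := hsqc.smul_right
  have hdiv : Integrable fun x ↦ φ x ^ 2 * ediv X x :=
    hsqc.integrable_mul_of_continuousOn hΩ (hsqs.trans hφΩ) hsq.continuous
      (hX.continuousOn_ediv hΩ)
  have hnorm : Integrable fun x ↦ φ x ^ 2 * ‖X x‖ ^ 2 :=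
    hsqc.integrable_mul_of_continuousOn hΩ (hsqs.trans hφΩ) hsq.continuous
      (hX.continuousOn.norm.pow 2)
  have hgradn (x) : ‖gradient φ x‖ = ‖fderiv ℝ φ x‖ := LinearIsometryEquiv.norm_map _ _
  have hfd0 {x} (hx : x ∉ Ω) : fderiv ℝ φ x = 0 :=
    image_eq_zero_of_notMem_tsupport fun h ↦ hx (hφΩ (tsupport_fderiv_subset ℝ h))
  have hφ0 {x} (hx : x ∉ Ω) : φ x = 0 := image_eq_zero_of_notMem_tsupport fun h ↦ hx (hφΩ h)
  have hgrad : Integrable fun x ↦ ‖gradient φ x‖ ^ 2 := by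
    simp only [hgradn]
    exact ((hφ.continuous_fderiv (by simp)).norm.pow 2).integrable_of_hasCompactSupport
      ((hφc.fderiv (𝕜 := ℝ)).mono fun x hx h0 ↦ hx (by simp [h0]))
  rw [setIntegral_eq_integral_of_forall_compl_eq_zero fun x hx ↦ by simp [hφ0 hx],
    setIntegral_eq_integral_of_forall_compl_eq_zero fun x hx ↦ by simp [hgradn, hfd0 hx],
    setIntegral_eq_integral_of_forall_compl_eq_zero fun x hx ↦ by simp [hφ0 hx],
    ← integral_add hgrad hnorm, ← sub_zero (∫ x, φ x ^ 2 * ediv X x),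
    ← hY.integral_ediv_eq_zero hYc, ← integral_sub hdiv (hY.integrable_ediv hYc)]
  refine integral_mono (hdiv.sub (hY.integrable_ediv hYc)) (hgrad.add hnorm) fun x ↦ ?_
  dsimp only
  by_cases hx : x ∈ Ω
  · have hfsq : fderiv ℝ (fun y ↦ φ y ^ 2) x (X x) = 2 * φ x * fderiv ℝ φ x (X x) := by
      simp [fderiv_fun_pow 2 (hφd x)]
    rw [ediv_smul (hsq.differentiable one_ne_zero x) ((hXat hx).differentiableAt one_ne_zero),
      hfsq, hgradn]
    have hle : |φ x| * |fderiv ℝ φ x (X x)| ≤ |φ x| * (‖fderiv ℝ φ x‖ * ‖X x‖) :=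
      mul_le_mul_of_nonneg_left ((fderiv ℝ φ x).le_opNorm (X x)) (abs_nonneg _)
    have hneg := neg_abs_le (φ x * fderiv ℝ φ x (X x))
    rw [abs_mul] at hneg
    rw [← sq_abs (φ x)]
    nlinarith [sq_nonneg (‖fderiv ℝ φ x‖ - |φ x| * ‖X x‖)]
  · have hYx : ediv (fun y ↦ φ y ^ 2 • X y) x = 0 := by
      have : fderiv ℝ (fun y ↦ φ y ^ 2 • X y) x = 0 :=
        image_eq_zero_of_notMem_tsupport fun h ↦
          hx (hφΩ (hsqs (tsupport_smul_subset_left _ _ (tsupport_fderiv_subset ℝ h))))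
      simp [ediv, this]
    rw [hYx, hφ0 hx]
    simp
end

section
/- Let n ≥ 2 be an integer, let κ ∈ ℝ, and let 0 < r < ∞, with r < π/√κ when κ > 0. Let f : [0, r] → ℝ be smooth with f(0) = 0, f′(0) = 1, and f(t) > 0 for all t ∈ (0, r]. Suppose that either f′(t)/f(t) ≥ S_κ′(t)/S_κ(t) for all t ∈ (0, r), or f′(t)/f(t) ≤ S_κ′(t)/S_κ(t) for all t ∈ (0, r). If μ_n(f, r) = μ_n(S_κ, r), then f(t) = S_κ(t) for all t ∈ [0, r]. -/
open scoped ENNReal Topology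
open MeasureTheory

/-- `Sk κ` is the function `S_κ`: `sinh(√(-κ) t)/√(-κ)` for `κ < 0`, `t` for `κ = 0`,
and `sin(√κ t)/√κ` for `κ > 0`. -/
noncomputable def Sk (κ : ℝ) (t : ℝ) : ℝ :=
  if κ < 0 then Real.sinh (Real.sqrt (-κ) * t) / Real.sqrt (-κ)
  else if κ = 0 then t
  else Real.sin (Real.sqrt κ * t) / Real.sqrt κ

/-- The weighted fundamental tone `μ_n(w, ·)` on the interval `s ⊆ ℝ`: the infimum of
`∫_s φ'(t)² w(t)^(n-1) dt / ∫_s φ(t)² w(t)^(n-1) dt` over all smooth `φ : ℝ → ℝ`, not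
identically zero, with compact support contained in `s`.  Taking `s = Set.Ioo 0 r` gives
`μ_n(w, r)` and `s = Set.Ioi 0` gives `μ_n(w, ∞)`. -/
noncomputable def mu (n : ℕ) (w : ℝ → ℝ) (s : Set ℝ) : ℝ :=
  sInf { q : ℝ | ∃ φ : ℝ → ℝ, ContDiff ℝ (⊤ : ℕ∞) φ ∧ HasCompactSupport φ ∧ tsupport φ ⊆ s ∧
    φ ≠ 0 ∧
    q = (∫ t in s, deriv φ t ^ 2 * w t ^ (n - 1)) / ∫ t in s, φ t ^ 2 * w t ^ (n - 1) }

open Set Filter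

/-- A weight on `[0, r]` which is positive and smooth away from `0`, almost increasing, and which
vanishes at least linearly at `0`. -/
structure IsRadialWeight (p : ℝ → ℝ) (r : ℝ) : Prop where
  continuousOn : ContinuousOn p (Icc 0 r)
  contDiffOn : ContDiffOn ℝ (⊤ : ℕ∞) p (Ioo 0 r)
  pos : ∀ t ∈ Ioc 0 r, 0 < p t
  exists_le_mul : ∃ C, 0 < C ∧ ∀ x s, 0 < x → x ≤ s → s ≤ r → p x ≤ C * p s
  exists_le_linear : ∃ C, 0 < C ∧ ∀ t ∈ Ioc 0 r, p t ≤ C * t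

/-- `u` is a solution, regular at `0`, of `(p u')' = p g` on `(0, r)` with flux `J = p u'`. -/
structure IsRadialSolution (p : ℝ → ℝ) (r : ℝ) (g u J : ℝ → ℝ) : Prop where
  continuousOn : ContinuousOn u (Icc 0 r)
  continuousOn_flux : ContinuousOn J (Icc 0 r)
  flux_zero : J 0 = 0
  hasDerivAt : ∀ t ∈ Ioo 0 r, HasDerivAt u (J t / p t) t
  hasDerivAt_flux : ∀ t ∈ Ioo 0 r, HasDerivAt J (p t * g t) t

lemma intervalIntegrable_of_continuousOn_Icc {g : ℝ → ℝ} {r s t : ℝ}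
    (hg : ContinuousOn g (Icc 0 r)) (hs : s ∈ Icc 0 r) (ht : t ∈ Icc 0 r) :
    IntervalIntegrable g volume s t :=
  (hg.mono (uIcc_subset_Icc hs ht)).intervalIntegrable

lemma continuousOn_primitive_Icc {g : ℝ → ℝ} {r : ℝ} (hr : 0 ≤ r)
    (hg : ContinuousOn g (Icc 0 r)) :
    ContinuousOn (fun t => ∫ x in (0 : ℝ)..t, g x) (Icc 0 r) := by
  have h := intervalIntegral.continuousOn_primitive_interval (f := g) (a := 0) (b := r)
    (μ := volume)
  rw [uIcc_of_le hr] at h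
  exact h hg.integrableOn_Icc

lemma hasDerivAt_primitive_Icc {g : ℝ → ℝ} {r s t : ℝ} (hg : ContinuousOn g (Icc 0 r))
    (hs : s ∈ Icc 0 r) (ht : t ∈ Ioo 0 r) :
    HasDerivAt (fun t => ∫ x in s..t, g x) (g t) t :=
  intervalIntegral.integral_hasDerivAt_right
    (intervalIntegrable_of_continuousOn_Icc hg hs (Ioo_subset_Icc_self ht))
    ((hg.mono Ioo_subset_Icc_self).stronglyMeasurableAtFilter isOpen_Ioo t ht)
    (hg.continuousAt (Icc_mem_nhds ht.1 ht.2))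

/-- The flux of the regular solution of `(p u')' = p g`. -/
noncomputable def radialFlux (p g : ℝ → ℝ) (t : ℝ) : ℝ := ∫ x in (0 : ℝ)..t, p x * g x

/-- The regular solution of `(p u')' = p g` vanishing at `0`. -/
noncomputable def radialPotential (p g : ℝ → ℝ) (t : ℝ) : ℝ :=
  ∫ s in (0 : ℝ)..t, radialFlux p g s / p s

lemma abs_radialFlux_div_le {p g : ℝ → ℝ} {r C N s : ℝ} (hp : IsRadialWeight p r)
    (hC : ∀ x s, 0 < x → x ≤ s → s ≤ r → p x ≤ C * p s) (hs : s ∈ Icc 0 r)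
    (hN : ∀ x ∈ Icc 0 s, |g x| ≤ N) : |radialFlux p g s / p s| ≤ C * N * s := by
  rcases hs.1.eq_or_lt with rfl | hs0
  · simp [radialFlux]
  have hps := hp.pos s ⟨hs0, hs.2⟩
  rw [abs_div, abs_of_pos hps, div_le_iff₀ hps]
  have h := intervalIntegral.norm_integral_le_of_norm_le_const (a := 0) (b := s)
    (f := fun x => p x * g x) (C := C * p s * N) (by
      intro x hx
      rw [uIoc_of_le hs0.le] at hx
      have hpx := hp.pos x ⟨hx.1, hx.2.trans hs.2⟩
      rw [Real.norm_eq_abs, abs_mul, abs_of_pos hpx]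
      have h1 := hC x s hx.1 hx.2 hs.2
      exact mul_le_mul h1 (hN x ⟨hx.1.le, hx.2⟩) (abs_nonneg _) (hpx.le.trans h1))
  rw [Real.norm_eq_abs, sub_zero, abs_of_pos hs0] at h
  calc |radialFlux p g s| ≤ C * p s * N * s := h
    _ = C * N * s * p s := by ring

lemma IsRadialWeight.isRadialSolution_const_add {p g : ℝ → ℝ} {r : ℝ} (hr : 0 < r)
    (hp : IsRadialWeight p r) (hg : ContinuousOn g (Icc 0 r)) (c : ℝ) :
    ContinuousOn (fun s => radialFlux p g s / p s) (Icc 0 r) ∧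
    IsRadialSolution p r g (fun t => c + radialPotential p g t) (radialFlux p g) := by
  have hpg : ContinuousOn (fun x => p x * g x) (Icc 0 r) := hp.continuousOn.mul hg
  have hJ : ContinuousOn (radialFlux p g) (Icc 0 r) := continuousOn_primitive_Icc hr.le hpg
  have hG : ContinuousOn (fun s => radialFlux p g s / p s) (Icc 0 r) := by
    intro s hs
    rcases hs.1.eq_or_lt with rfl | hs0
    · obtain ⟨C, hC0, hC⟩ := hp.exists_le_mul
      obtain ⟨N, hN⟩ := isCompact_Icc.exists_bound_of_continuousOn hg
      rw [ContinuousWithinAt]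
      have h0 : radialFlux p g 0 / p 0 = 0 := by simp [radialFlux]
      rw [h0]
      refine squeeze_zero_norm' (a := fun s => C * N * s) ?_ ?_
      · filter_upwards [self_mem_nhdsWithin] with s hs
        exact abs_radialFlux_div_le hp hC hs fun x hx => hN x ⟨hx.1, hx.2.trans hs.2⟩
      · have : Continuous fun s : ℝ => C * N * s := by fun_prop
        have := this.tendsto 0
        rw [mul_zero] at this
        exact this.mono_left nhdsWithin_le_nhds
    · exact (hJ s hs).div (hp.continuousOn s hs) (hp.pos s ⟨hs0, hs.2⟩).ne'
  refine ⟨hG, ⟨continuousOn_const.add (continuousOn_primitive_Icc hr.le hG), hJ,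
    by simp [radialFlux], fun t ht => ?_, fun t ht => ?_⟩⟩
  · exact (hasDerivAt_primitive_Icc hG (left_mem_Icc.2 hr.le) ht).const_add c
  · exact hasDerivAt_primitive_Icc hpg (left_mem_Icc.2 hr.le) ht

lemma abs_radialPotential_le {p g : ℝ → ℝ} {r C N K t : ℝ} (hr : 0 < r)
    (hp : IsRadialWeight p r) (hC0 : 0 < C)
    (hC : ∀ x s, 0 < x → x ≤ s → s ≤ r → p x ≤ C * p s) (hK : 0 < K) (hN0 : 0 ≤ N)
    (hN : ∀ x ∈ Icc 0 r, |g x| ≤ N * Real.exp (K * x)) (ht : t ∈ Icc 0 r) :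
    |radialPotential p g t| ≤ C * r / K * N * Real.exp (K * t) := by
  have hder : ∀ x : ℝ, HasDerivAt (fun x => C * r / K * N * Real.exp (K * x))
      (C * r * N * Real.exp (K * x)) x := fun x => by
    have h := (((hasDerivAt_id x).const_mul K).exp).const_mul (C * r / K * N)
    rw [show C * r * N * Real.exp (K * x) = C * r / K * N * (Real.exp (K * x) * (K * 1)) by
      field_simp]
    exact h
  have hcont : Continuous fun x => C * r * N * Real.exp (K * x) := by fun_prop
  have hint := intervalIntegral.integral_eq_sub_of_hasDerivAt (a := 0) (b := t)
    (fun x _ => hder x) (hcont.intervalIntegrable 0 t)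
  have h := intervalIntegral.norm_integral_le_of_norm_le (a := 0) (b := t) (μ := volume)
    (f := fun s => radialFlux p g s / p s) ht.1 (ae_of_all _ fun s hs => by
      have hs' : s ∈ Icc 0 r := ⟨hs.1.le, hs.2.trans ht.2⟩
      calc ‖radialFlux p g s / p s‖ ≤ C * (N * Real.exp (K * s)) * s :=
            abs_radialFlux_div_le hp hC hs' fun x hx =>
              (hN x ⟨hx.1, hx.2.trans hs'.2⟩).trans (by have := hx.2; gcongr)
        _ ≤ C * (N * Real.exp (K * s)) * r := by have := hs'.2; gcongr
        _ = C * r * N * Real.exp (K * s) := by ring) (hcont.intervalIntegrable 0 t)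
  rw [hint] at h
  refine h.trans (sub_le_self _ (by positivity))

lemma radialPotential_sub {p g h : ℝ → ℝ} {r t : ℝ} (hr : 0 < r) (hp : IsRadialWeight p r)
    (hg : ContinuousOn g (Icc 0 r)) (hh : ContinuousOn h (Icc 0 r)) (ht : t ∈ Icc 0 r) :
    radialPotential p (fun x => g x - h x) t = radialPotential p g t - radialPotential p h t := by
  have h0 : (0 : ℝ) ∈ Icc 0 r := left_mem_Icc.2 hr.le
  have hpg : ContinuousOn (fun x => p x * g x) (Icc 0 r) := hp.continuousOn.mul hg
  have hph : ContinuousOn (fun x => p x * h x) (Icc 0 r) := hp.continuousOn.mul hh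
  unfold radialPotential
  rw [← intervalIntegral.integral_sub
    (intervalIntegrable_of_continuousOn_Icc (hp.isRadialSolution_const_add hr hg 0).1 h0 ht)
    (intervalIntegrable_of_continuousOn_Icc (hp.isRadialSolution_const_add hr hh 0).1 h0 ht)]
  refine intervalIntegral.integral_congr fun s hs => ?_
  rw [uIcc_of_le ht.1] at hs
  have hs' : s ∈ Icc 0 r := ⟨hs.1, hs.2.trans ht.2⟩
  have := intervalIntegral.integral_sub (μ := volume)
    (intervalIntegrable_of_continuousOn_Icc hpg h0 hs')
    (intervalIntegrable_of_continuousOn_Icc hph h0 hs')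
  simp only [radialFlux, mul_sub, ← sub_div, ← this]

/-- Existence of the regular solution of `(p u')' = -l p u`, `u(0) = 1`. -/
lemma IsRadialWeight.exists_eigenSolution {p : ℝ → ℝ} {r : ℝ} (hr : 0 < r)
    (hp : IsRadialWeight p r) (l : ℝ) :
    ∃ u J, u 0 = 1 ∧ IsRadialSolution p r (fun t => -l * u t) u J := by
  obtain ⟨C, hC0, hC⟩ := hp.exists_le_mul
  set K : ℝ := 2 * C * r * (|l| + 1) with hKdef
  have hK : 0 < K := by positivity
  let E : C(Icc (0 : ℝ) r, ℝ) → ℝ → ℝ := fun h x => Real.exp (K * x) * IccExtend hr.le h x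
  have hE : ∀ h, Continuous (E h) := fun h => by
    have := h.continuous.Icc_extend' (h := hr.le)
    exact (by fun_prop : Continuous fun x => Real.exp (K * x)).mul this
  let S : C(Icc (0 : ℝ) r, ℝ) → ℝ → ℝ := fun h t => 1 + radialPotential p (fun x => -l * E h x) t
  have hS : ∀ h, IsRadialSolution p r (fun x => -l * E h x) (S h)
      (radialFlux p fun x => -l * E h x) := fun h =>
    (hp.isRadialSolution_const_add hr (continuous_const.mul (hE h)).continuousOn 1).2
  let A : C(Icc (0 : ℝ) r, ℝ) → C(Icc (0 : ℝ) r, ℝ) := fun h =>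
    ⟨fun t => Real.exp (-(K * t)) * S h t,
      (by fun_prop : Continuous fun t : Icc (0 : ℝ) r => Real.exp (-(K * t))).mul
        (hS h).continuousOn.domRestrict⟩
  have hA : ContractingWith (1 / 2) A := by
    refine ⟨by norm_num [← NNReal.coe_lt_coe], LipschitzWith.of_dist_le_mul fun g h => ?_⟩
    rw [ContinuousMap.dist_le (by positivity)]
    intro t
    have hsub := radialPotential_sub hr hp (continuous_const.mul (hE g)).continuousOn
      (continuous_const.mul (hE h)).continuousOn t.2 (g := fun x => -l * E g x)
      (h := fun x => -l * E h x)
    have hb := abs_radialPotential_le (N := |l| * dist g h) hr hp hC0 hC hK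
      (by positivity) (fun x hx => by
        have h1 := ContinuousMap.dist_apply_le_dist (f := g) (g := h) ⟨x, hx⟩
        rw [Real.dist_eq] at h1
        simp only [E, IccExtend_of_mem _ _ hx]
        rw [show -l * (Real.exp (K * x) * g ⟨x, hx⟩) - -l * (Real.exp (K * x) * h ⟨x, hx⟩)
          = -l * (g ⟨x, hx⟩ - h ⟨x, hx⟩) * Real.exp (K * x) by ring, abs_mul, abs_mul, abs_neg,
          abs_of_pos (Real.exp_pos _)]
        gcongr) t.2 (g := fun x => -l * E g x - -l * E h x)
    rw [hsub] at hb
    simp only [A, S, ContinuousMap.coe_mk, Real.dist_eq]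
    rw [← mul_sub, add_sub_add_left_eq_sub, abs_mul, abs_of_pos (Real.exp_pos _)]
    calc Real.exp (-(K * t)) * _ ≤ Real.exp (-(K * t)) *
          (C * r / K * (|l| * dist g h) * Real.exp (K * t)) := by gcongr
      _ = C * r / K * |l| * dist g h := by
          rw [Real.exp_neg]; field_simp
      _ ≤ ((1 / 2 : NNReal) : ℝ) * dist g h := by
          gcongr
          rw [div_mul_eq_mul_div, div_le_iff₀ hK, hKdef]
          push_cast
          nlinarith [mul_pos hC0 hr]
  let h := hA.fixedPoint A
  have hfix : A h = h := hA.fixedPoint_isFixedPt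
  have hES : ∀ t ∈ Icc 0 r, E h t = S h t := fun t ht => by
    have h1 := congrArg (fun k : C(Icc (0 : ℝ) r, ℝ) => k ⟨t, ht⟩) hfix
    simp only [A, ContinuousMap.coe_mk] at h1
    simp only [E, IccExtend_of_mem _ _ ht, ← h1]
    rw [Real.exp_neg]
    field_simp
  refine ⟨S h, _, by simp [S, radialPotential], (hS h).continuousOn, (hS h).continuousOn_flux,
    (hS h).flux_zero, (hS h).hasDerivAt, fun t ht => ?_⟩
  rw [← hES t (Ioo_subset_Icc_self ht)]
  exact (hS h).hasDerivAt_flux t ht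

lemma monotoneOn_Icc_of_hasDerivAt_nonneg {F F' : ℝ → ℝ} {a b : ℝ}
    (hF : ContinuousOn F (Icc a b)) (hF' : ∀ t ∈ Ioo a b, HasDerivAt F (F' t) t)
    (h : ∀ t ∈ Ioo a b, 0 ≤ F' t) : MonotoneOn F (Icc a b) := by
  refine monotoneOn_of_deriv_nonneg (convex_Icc a b) hF ?_ ?_ <;> rw [interior_Icc]
  · exact fun t ht => (hF' t ht).differentiableAt.differentiableWithinAt
  · exact fun t ht => (hF' t ht).deriv ▸ h t ht

lemma strictAntiOn_Icc_of_hasDerivAt_neg {F F' : ℝ → ℝ} {a b : ℝ}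
    (hF : ContinuousOn F (Icc a b)) (hF' : ∀ t ∈ Ioo a b, HasDerivAt F (F' t) t)
    (h : ∀ t ∈ Ioo a b, F' t < 0) : StrictAntiOn F (Icc a b) := by
  refine strictAntiOn_of_deriv_neg (convex_Icc a b) hF ?_
  rw [interior_Icc]
  exact fun t ht => (hF' t ht).deriv ▸ h t ht

/-- The admissible functions in the definition of `mu` on `(0, r)`. -/
structure IsTestFunction (r : ℝ) (φ : ℝ → ℝ) : Prop where
  contDiff : ContDiff ℝ (⊤ : ℕ∞) φ
  hasCompactSupport : HasCompactSupport φ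
  tsupport_subset : tsupport φ ⊆ Ioo 0 r
  ne_zero : φ ≠ 0

lemma setIntegral_Ioo_eq_intervalIntegral {r : ℝ} (hr : 0 ≤ r) (g : ℝ → ℝ) :
    ∫ t in Ioo 0 r, g t = ∫ t in (0 : ℝ)..r, g t := by
  rw [intervalIntegral.integral_of_le hr, integral_Ioc_eq_integral_Ioo]

lemma IsTestFunction.continuous_deriv {r : ℝ} {φ : ℝ → ℝ} (hφ : IsTestFunction r φ) :
    Continuous (deriv φ) := hφ.contDiff.continuous_deriv (by simp)

lemma IsTestFunction.mass_pos {p φ : ℝ → ℝ} {r : ℝ} (hr : 0 < r) (hp : IsRadialWeight p r)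
    (hφ : IsTestFunction r φ) : 0 < ∫ t in Ioo 0 r, φ t ^ 2 * p t := by
  rw [setIntegral_Ioo_eq_intervalIntegral hr.le]
  obtain ⟨c, hc⟩ := Function.ne_iff.1 hφ.ne_zero
  have hc' := hφ.tsupport_subset (subset_tsupport φ hc)
  refine intervalIntegral.integral_pos hr
    ((hφ.contDiff.continuous.pow 2).continuousOn.mul hp.continuousOn)
    (fun x hx => mul_nonneg (sq_nonneg _) (hp.pos x hx).le) ⟨c, Ioo_subset_Icc_self hc', ?_⟩
  exact mul_pos (sq_pos_of_ne_zero hc) (hp.pos c (Ioo_subset_Ioc_self hc'))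

lemma exists_isTestFunction {r : ℝ} (hr : 0 < r) : ∃ φ, IsTestFunction r φ := by
  obtain ⟨φ, h1, h2, h3, -, h5⟩ := exists_contDiff_tsupport_subset (n := (⊤ : ℕ∞))
    (Ioo_mem_nhds (half_pos hr) (half_lt_self hr))
  exact ⟨φ, h3, h2, h1, fun h => by simp [h] at h5⟩

lemma le_mu {n : ℕ} {w : ℝ → ℝ} {r l : ℝ} (hr : 0 < r)
    (hw : IsRadialWeight (fun t => w t ^ (n - 1)) r)
    (h : ∀ φ, IsTestFunction r φ → l * ∫ t in Ioo 0 r, φ t ^ 2 * w t ^ (n - 1) ≤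
      ∫ t in Ioo 0 r, deriv φ t ^ 2 * w t ^ (n - 1)) :
    l ≤ mu n w (Ioo 0 r) := by
  refine le_csInf ?_ ?_
  · obtain ⟨φ, hφ⟩ := exists_isTestFunction hr
    exact ⟨_, φ, hφ.1, hφ.2, hφ.3, hφ.4, rfl⟩
  · rintro _ ⟨φ, h1, h2, h3, h4, rfl⟩
    have hφ : IsTestFunction r φ := ⟨h1, h2, h3, h4⟩
    exact (le_div_iff₀ (hφ.mass_pos hr hw)).2 (h φ hφ)

lemma mu_mul_le {n : ℕ} {w φ : ℝ → ℝ} {r : ℝ} (hr : 0 < r)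
    (hw : IsRadialWeight (fun t => w t ^ (n - 1)) r) (hφ : IsTestFunction r φ) :
    mu n w (Ioo 0 r) * ∫ t in Ioo 0 r, φ t ^ 2 * w t ^ (n - 1) ≤
      ∫ t in Ioo 0 r, deriv φ t ^ 2 * w t ^ (n - 1) := by
  rw [← le_div_iff₀ (hφ.mass_pos hr hw)]
  refine csInf_le ⟨0, ?_⟩ ⟨φ, hφ.1, hφ.2, hφ.3, hφ.4, rfl⟩
  rintro _ ⟨ψ, h1, h2, h3, h4, rfl⟩
  have hψ : IsTestFunction r ψ := ⟨h1, h2, h3, h4⟩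
  exact div_nonneg (setIntegral_nonneg measurableSet_Ioo fun t ht =>
    mul_nonneg (sq_nonneg _) (hw.pos t (Ioo_subset_Ioc_self ht)).le) (hψ.mass_pos hr hw).le

/-- **Barta's inequality**: a positive supersolution bounds the Rayleigh quotient from below. -/
lemma IsTestFunction.mul_mass_le_energy {q w Y s φ : ℝ → ℝ} {r l : ℝ} (hr : 0 < r)
    (hq : IsRadialWeight q r) (hw : ∀ t ∈ Ioo 0 r, 0 < w t)
    (hw' : ∀ t ∈ Ioo 0 r, HasDerivAt w (Y t / q t) t)
    (hY : ∀ t ∈ Ioo 0 r, HasDerivAt Y (-(q t * s t)) t)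
    (hs : ∀ t ∈ Ioo 0 r, l * w t ≤ s t) (hφ : IsTestFunction r φ) :
    l * ∫ t in Ioo 0 r, φ t ^ 2 * q t ≤ ∫ t in Ioo 0 r, deriv φ t ^ 2 * q t := by
  rw [setIntegral_Ioo_eq_intervalIntegral hr.le, setIntegral_Ioo_eq_intervalIntegral hr.le]
  have hm : ContinuousOn (fun t => φ t ^ 2 * q t) (Icc 0 r) :=
    (hφ.contDiff.continuous.pow 2).continuousOn.mul hq.continuousOn
  have he : ContinuousOn (fun t => deriv φ t ^ 2 * q t) (Icc 0 r) :=
    (hφ.continuous_deriv.pow 2).continuousOn.mul hq.continuousOn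
  have h0 : (0 : ℝ) ∈ Icc 0 r := left_mem_Icc.2 hr.le
  have h1 : r ∈ Icc 0 r := right_mem_Icc.2 hr.le
  have hder : ∀ t ∈ Ioo 0 r, HasDerivAt (fun t => φ t ^ 2 * Y t / w t)
      (deriv φ t ^ 2 * q t - q t * (deriv φ t - φ t * Y t / (q t * w t)) ^ 2
        - φ t ^ 2 * q t * s t / w t) t := fun t ht => by
    have hφt := (hφ.contDiff.differentiable (by simp) t).hasDerivAt
    have hwt := hw t ht
    have hqt := hq.pos t (Ioo_subset_Ioc_self ht)
    have h := ((hφt.fun_pow 2).mul (hY t ht)).fun_div (hw' t ht) hwt.ne'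
    refine h.congr_deriv ?_
    simp only [Pi.mul_apply]
    field_simp
    ring
  have hoff : ∀ t, t ∉ Ioo 0 r → (fun t => φ t ^ 2 * Y t / w t) =ᶠ[𝓝 t] fun _ => 0 :=
    fun t ht => by
      have := notMem_tsupport_iff_eventuallyEq.1 fun h => ht (hφ.tsupport_subset h)
      filter_upwards [this] with x hx
      simp [hx]
  have key := intervalIntegral.sub_le_integral_of_hasDeriv_right_of_le hr.le
    (g := fun t => φ t ^ 2 * Y t / w t)
    (φ := fun t => deriv φ t ^ 2 * q t - l * (φ t ^ 2 * q t))
    (fun t _ => by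
      by_cases ht : t ∈ Ioo 0 r
      · exact (hder t ht).continuousAt.continuousWithinAt
      · exact ((hoff t ht).continuousAt).continuousWithinAt)
    (fun t ht => (hder t ht).hasDerivWithinAt)
    ((he.sub (continuousOn_const.mul hm)).integrableOn_Icc) (fun t ht => by
      have hwt := hw t ht
      have hqt := hq.pos t (Ioo_subset_Ioc_self ht)
      have h2 : l * (φ t ^ 2 * q t) ≤ φ t ^ 2 * q t * s t / w t := by
        rw [le_div_iff₀ hwt]
        have := mul_le_mul_of_nonneg_left (hs t ht) (by positivity : 0 ≤ φ t ^ 2 * q t)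
        linarith
      have h3 : 0 ≤ q t * (deriv φ t - φ t * Y t / (q t * w t)) ^ 2 := by positivity
      linarith)
  have hF0 : φ 0 ^ 2 * Y 0 / w 0 = 0 := (hoff 0 (by simp)).self_of_nhds
  have hFr : φ r ^ 2 * Y r / w r = 0 := (hoff r (by simp)).self_of_nhds
  rw [hF0, hFr, intervalIntegral.integral_sub (intervalIntegrable_of_continuousOn_Icc he h0 h1)
      ((intervalIntegrable_of_continuousOn_Icc hm h0 h1).const_mul l),
    intervalIntegral.integral_const_mul] at key
  linarith

lemma lt_mu_of_eigenSolution_pos {n : ℕ} {w v K : ℝ → ℝ} {r l : ℝ} (hr : 0 < r)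
    (hw : IsRadialWeight (fun t => w t ^ (n - 1)) r) (hl : 0 ≤ l)
    (hv : IsRadialSolution (fun t => w t ^ (n - 1)) r (fun t => -l * v t) v K)
    (hpos : ∀ t ∈ Icc 0 r, 0 < v t) : l < mu n w (Ioo 0 r) := by
  set q : ℝ → ℝ := fun t => w t ^ (n - 1) with hq
  have hne : (Icc 0 r).Nonempty := ⟨0, left_mem_Icc.2 hr.le⟩
  obtain ⟨-, hh⟩ := hw.isRadialSolution_const_add hr
    (g := fun _ => 1) continuousOn_const 0
  set H := radialFlux q fun _ => 1
  set h : ℝ → ℝ := fun t => 0 + radialPotential q (fun _ => 1) t with hh_def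
  have hH0 : ∀ t ∈ Icc 0 r, 0 ≤ H t := fun t ht => by
    rw [← hh.flux_zero]
    exact monotoneOn_Icc_of_hasDerivAt_nonneg hh.continuousOn_flux hh.hasDerivAt_flux
      (fun x hx => by simpa using (hw.pos x (Ioo_subset_Ioc_self hx)).le) (left_mem_Icc.2 hr.le)
      ht ht.1
  have hh0 : ∀ t ∈ Icc 0 r, 0 ≤ h t := fun t ht => by
    have h0 : h 0 = 0 := by simp [hh_def, radialPotential]
    rw [← h0]
    exact monotoneOn_Icc_of_hasDerivAt_nonneg hh.continuousOn hh.hasDerivAt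
      (fun x hx => div_nonneg (hH0 x (Ioo_subset_Icc_self hx))
        (hw.pos x (Ioo_subset_Ioc_self hx)).le) (left_mem_Icc.2 hr.le) ht ht.1
  obtain ⟨x₀, hx₀, hmin⟩ := isCompact_Icc.exists_isMinOn hne hv.continuousOn
  obtain ⟨M, hM⟩ := isCompact_Icc.exists_bound_of_continuousOn hv.continuousOn
  obtain ⟨B, hB⟩ := isCompact_Icc.exists_bound_of_continuousOn hh.continuousOn
  have hc := hpos x₀ hx₀
  have hM0 : 0 < M := hc.trans_le ((le_abs_self _).trans (hM x₀ hx₀))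
  have hB0 : 0 ≤ B := (norm_nonneg _).trans (hB x₀ hx₀)
  set δ := v x₀ / (2 * (B + 1)) with hδ
  have hδ0 : 0 < δ := by positivity
  refine (lt_add_of_pos_right l (div_pos hδ0 hM0)).trans_le (le_mu hr hw fun φ hφ => ?_)
  refine hφ.mul_mass_le_energy hr hw (w := fun t => v t - δ * h t)
    (Y := fun t => K t - δ * H t) (s := fun t => l * v t + δ) ?_ ?_ ?_ ?_
  · intro t ht
    have ht' := Ioo_subset_Icc_self ht
    have h1 : v x₀ ≤ v t := hmin ht'
    have h2 : h t ≤ B := (le_abs_self _).trans (hB t ht')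
    have h3 : δ * h t ≤ δ * B := by gcongr
    have h4 : δ * (2 * (B + 1)) = v x₀ := by rw [hδ]; field_simp
    nlinarith
  · intro t ht
    refine ((hv.hasDerivAt t ht).sub ((hh.hasDerivAt t ht).const_mul δ)).congr_deriv ?_
    ring
  · intro t ht
    refine ((hv.hasDerivAt_flux t ht).sub ((hh.hasDerivAt_flux t ht).const_mul δ)).congr_deriv ?_
    ring
  · intro t ht
    have ht' := Ioo_subset_Icc_self ht
    have h1 : v t ≤ M := (le_abs_self _).trans (hM t ht')
    have h2 : δ / M * v t ≤ δ := by
      rw [div_mul_eq_mul_div, div_le_iff₀ hM0]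
      gcongr
    have h3 : 0 ≤ (l + δ / M) * (δ * h t) := by
      have := hh0 t ht'
      positivity
    linarith

lemma IsRadialSolution.flux_neg {p u J : ℝ → ℝ} {r l t : ℝ} (hp : IsRadialWeight p r)
    (hl : 0 < l) (hu : IsRadialSolution p r (fun t => -l * u t) u J) (ht : t ∈ Ioc 0 r)
    (hpos : ∀ x ∈ Ioo 0 t, 0 < u x) : J t < 0 := by
  have hsub : Ioo 0 t ⊆ Ioo 0 r := Ioo_subset_Ioo_right ht.2
  have h := strictAntiOn_Icc_of_hasDerivAt_neg
    (hu.continuousOn_flux.mono (Icc_subset_Icc_right ht.2))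
    (fun x hx => hu.hasDerivAt_flux x (hsub hx)) (fun x hx => by
      have h1 := hp.pos x (Ioo_subset_Ioc_self (hsub hx))
      have h2 := hpos x hx
      have : 0 < p x * (l * u x) := by positivity
      linarith)
    (left_mem_Icc.2 ht.1.le) (right_mem_Icc.2 ht.1.le) ht.1
  rwa [hu.flux_zero] at h

/-- A Sturm comparison: if `q = R p` with `R` nondecreasing, the `q`-solution `v` stays positive at
least as long as the `p`-solution `u`, strictly so unless `R` is constant. -/
lemma eigenSolution_pos_or_ratio_constant {p q R R' u J v K : ℝ → ℝ} {r l : ℝ} (hl : 0 < l)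
    (hp : IsRadialWeight p r) (hq : IsRadialWeight q r) (hRc : ContinuousOn R (Icc 0 r))
    (hR : ∀ t ∈ Ioo 0 r, HasDerivAt R (R' t) t) (hR' : ∀ t ∈ Ioo 0 r, 0 ≤ R' t)
    (hqR : ∀ t ∈ Ioc 0 r, q t = R t * p t)
    (hu : IsRadialSolution p r (fun t => -l * u t) u J)
    (hv : IsRadialSolution q r (fun t => -l * v t) v K) (hv0 : v 0 = 1)
    (hpos : ∀ t ∈ Ico 0 r, 0 < u t) :
    (∀ t ∈ Icc 0 r, 0 < v t) ∨ ∀ t ∈ Ioo 0 r, R' t = 0 := by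
  by_contra! hcon
  obtain ⟨⟨t₁, ht₁, hvt₁⟩, t₂, ht₂, hRt₂⟩ := hcon
  have hcompact : IsCompact {t ∈ Icc 0 r | v t ≤ 0} := by
    have : IsClosed {t ∈ Icc 0 r | v t ≤ 0} :=
      hv.continuousOn.preimage_isClosed_of_isClosed isClosed_Icc isClosed_Iic
    exact isCompact_Icc.of_isClosed_subset this fun t ht => ht.1
  obtain ⟨t₀, ⟨ht₀, hvt₀⟩, hmin⟩ := hcompact.exists_isLeast ⟨t₁, ht₁, hvt₁⟩
  have ht₀0 : 0 < t₀ := ht₀.1.lt_of_ne fun h => by rw [← h, hv0] at hvt₀; norm_num at hvt₀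
  have hvpos : ∀ x ∈ Ioo 0 t₀, 0 < v x := fun x hx => by
    by_contra! h
    exact (hmin ⟨⟨hx.1.le, hx.2.le.trans ht₀.2⟩, h⟩).not_gt hx.2
  have hsub : Ioo 0 t₀ ⊆ Ioo 0 r := Ioo_subset_Ioo_right ht₀.2
  have hJneg : ∀ t ∈ Ioc 0 t₀, J t < 0 := fun t ht =>
    hu.flux_neg hp hl ⟨ht.1, ht.2.trans ht₀.2⟩ fun x hx =>
      hpos x ⟨hx.1.le, hx.2.trans_le (ht.2.trans ht₀.2)⟩
  have hRpos : ∀ t ∈ Ioc 0 r, 0 < R t := fun t ht => by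
    have := hqR t ht ▸ hq.pos t ht
    exact (pos_iff_pos_of_mul_pos this).2 (hp.pos t ht)
  set W : ℝ → ℝ := fun t => K t * u t - R t * J t * v t with hW
  have hWc : ContinuousOn W (Icc 0 r) := (hv.continuousOn_flux.mul hu.continuousOn).sub
    ((hRc.mul hu.continuousOn_flux).mul hv.continuousOn)
  have hW' : ∀ t ∈ Ioo 0 r, HasDerivAt W (R' t * (-J t * v t)) t := fun t ht => by
    have ht' := Ioo_subset_Ioc_self ht
    have h1 := hp.pos t ht'
    have h2 := hRpos t ht'
    refine (((hv.hasDerivAt_flux t ht).fun_mul (hu.hasDerivAt t ht)).fun_sub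
      (((hR t ht).fun_mul (hu.hasDerivAt_flux t ht)).fun_mul (hv.hasDerivAt t ht))).congr_deriv ?_
    rw [hqR t ht']
    field_simp
    ring
  have hW0 : W 0 = 0 := by simp [hW, hu.flux_zero, hv.flux_zero]
  have hmono : MonotoneOn W (Icc 0 t₀) :=
    monotoneOn_Icc_of_hasDerivAt_nonneg (hWc.mono (Icc_subset_Icc_right ht₀.2))
      (fun t ht => hW' t (hsub ht)) fun t ht => by
        have h1 := hR' t (hsub ht)
        have h2 := hJneg t (Ioo_subset_Ioc_self ht)
        have h3 := hvpos t ht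
        exact mul_nonneg h1 (mul_nonneg (neg_nonneg.2 h2.le) h3.le)
  have hKneg : K t₀ < 0 := hv.flux_neg hq hl ⟨ht₀0, ht₀.2⟩ hvpos
  have hsecond : 0 ≤ R t₀ * J t₀ * v t₀ :=
    mul_nonneg_of_nonpos_of_nonpos (mul_nonpos_of_nonneg_of_nonpos
      (hRpos t₀ ⟨ht₀0, ht₀.2⟩).le (hJneg t₀ ⟨ht₀0, le_rfl⟩).le) hvt₀
  have hWnonneg : 0 ≤ W t₀ := hW0 ▸ hmono (left_mem_Icc.2 ht₀0.le) (right_mem_Icc.2 ht₀0.le) ht₀0.le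
  rcases ht₀.2.lt_or_eq with hlt | rfl
  · have := mul_neg_of_neg_of_pos hKneg (hpos t₀ ⟨ht₀0.le, hlt⟩)
    simp only [hW] at hWnonneg
    linarith
  · have hu0 : 0 ≤ u t₀ := by
      have hne : (𝓝[Ioo 0 t₀] t₀).NeBot := by
        rw [← mem_closure_iff_nhdsWithin_neBot, closure_Ioo ht₀0.ne]
        exact right_mem_Icc.2 ht₀0.le
      refine ge_of_tendsto ((hu.continuousOn t₀ ht₀).mono Ioo_subset_Icc_self) ?_
      filter_upwards [self_mem_nhdsWithin] with x hx
      exact (hpos x ⟨hx.1.le, hx.2⟩).le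
    have hWt₀ : W t₀ ≤ 0 := by
      have := mul_nonpos_of_nonpos_of_nonneg hKneg.le hu0
      simp only [hW]
      linarith
    have hWzero : ∀ t ∈ Icc 0 t₀, W t = 0 := fun t ht =>
      le_antisymm ((hmono ht ht₀ ht.2).trans hWt₀)
        (hW0 ▸ hmono (left_mem_Icc.2 ht₀0.le) ht ht.1)
    have h1 := (hW' t₂ ht₂).unique ((hasDerivAt_const t₂ (0 : ℝ)).congr_of_eventuallyEq (by
      filter_upwards [Icc_mem_nhds ht₂.1 ht₂.2] with x hx using hWzero x hx))
    have h2 := hJneg t₂ (Ioo_subset_Ioc_self ht₂)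
    have h3 := hvpos t₂ ht₂
    have h4 : 0 < -J t₂ * v t₂ := mul_pos (neg_pos.2 h2) h3
    exact hRt₂ ((mul_eq_zero.1 h1).resolve_right h4.ne')

/-- A smooth approximation, for small `δ > 0`, of the positive part `y ↦ max y 0`. -/
noncomputable def smoothPosPart (m : ℕ) (δ y : ℝ) : ℝ :=
  ∫ x in (0 : ℝ)..y, Real.smoothTransition (x / δ) ^ m

lemma continuous_smoothTransition_div_pow (m : ℕ) (δ : ℝ) :
    Continuous fun x : ℝ => Real.smoothTransition (x / δ) ^ m :=
  (Real.smoothTransition.continuous.comp (continuous_id.div_const δ)).pow m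

lemma hasDerivAt_smoothPosPart (m : ℕ) (δ y : ℝ) :
    HasDerivAt (smoothPosPart m δ) (Real.smoothTransition (y / δ) ^ m) y :=
  (continuous_smoothTransition_div_pow m δ).integral_hasStrictDerivAt 0 y |>.hasDerivAt

lemma contDiff_smoothPosPart (m : ℕ) (δ : ℝ) :
    ContDiff ℝ (⊤ : ℕ∞) (smoothPosPart m δ) := by
  rw [contDiff_infty_iff_deriv]
  refine ⟨fun y => (hasDerivAt_smoothPosPart m δ y).differentiableAt, ?_⟩
  rw [show deriv (smoothPosPart m δ) = fun y => Real.smoothTransition (y / δ) ^ m from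
    funext fun y => (hasDerivAt_smoothPosPart m δ y).deriv]
  exact (Real.smoothTransition.contDiff.comp (contDiff_id.div_const δ)).pow m

lemma smoothPosPart_of_nonpos {m : ℕ} (hm : m ≠ 0) {δ y : ℝ} (hδ : 0 < δ) (hy : y ≤ 0) :
    smoothPosPart m δ y = 0 := by
  refine intervalIntegral.integral_zero_ae (ae_of_all _ fun x hx => ?_)
  rw [uIoc_of_ge hy] at hx
  rw [Real.smoothTransition.zero_of_nonpos (div_nonpos_of_nonpos_of_nonneg hx.2 hδ.le),
    zero_pow hm]

lemma smoothPosPart_nonneg {m : ℕ} (hm : m ≠ 0) {δ y : ℝ} (hδ : 0 < δ) :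
    0 ≤ smoothPosPart m δ y := by
  rcases le_total y 0 with hy | hy
  · exact (smoothPosPart_of_nonpos hm hδ hy).ge
  · exact intervalIntegral.integral_nonneg hy fun x _ =>
      pow_nonneg (Real.smoothTransition.nonneg _) _

lemma smoothPosPart_le {m : ℕ} (hm : m ≠ 0) {δ y : ℝ} (hδ : 0 < δ) :
    smoothPosPart m δ y ≤ max y 0 := by
  rcases le_total y 0 with hy | hy
  · rw [smoothPosPart_of_nonpos hm hδ hy]
    exact le_max_right _ _
  · have h := intervalIntegral.integral_mono_on (μ := volume) (g := fun _ => (1 : ℝ)) hy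
      ((continuous_smoothTransition_div_pow m δ).intervalIntegrable 0 y)
      (continuous_const.intervalIntegrable 0 y) fun x _ =>
        pow_le_one₀ (Real.smoothTransition.nonneg _) (Real.smoothTransition.le_one _)
    rw [intervalIntegral.integral_const, smul_eq_mul, mul_one, sub_zero] at h
    exact h.trans (le_max_left _ _)

lemma sub_le_smoothPosPart {m : ℕ} (hm : m ≠ 0) {δ y : ℝ} (hδ : 0 < δ) :
    max y 0 - δ ≤ smoothPosPart m δ y := by
  rcases le_total y δ with hy | hy
  · have := max_le hy hδ.le
    linarith [smoothPosPart_nonneg hm hδ (y := y)]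
  · have hc := continuous_smoothTransition_div_pow m δ
    have hsplit := intervalIntegral.integral_add_adjacent_intervals (μ := volume)
      (hc.intervalIntegrable 0 δ) (hc.intervalIntegrable δ y)
    have hone : ∫ x in δ..y, Real.smoothTransition (x / δ) ^ m = y - δ := by
      rw [intervalIntegral.integral_congr (g := fun _ => (1 : ℝ))]
      · simp
      · intro x hx
        rw [uIcc_of_le hy] at hx
        simp only
        rw [Real.smoothTransition.one_of_one_le ((one_le_div hδ).2 hx.1), one_pow]
    have h0 := smoothPosPart_nonneg hm hδ (y := δ)
    rw [max_eq_left (hδ.le.trans hy)]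
    unfold smoothPosPart at *
    linarith

/-- A singular solution of `(p k')' = 0` blowing up at `0`. -/
lemma IsRadialWeight.exists_singularSolution {p : ℝ → ℝ} {r t₁ : ℝ} (hp : IsRadialWeight p r)
    (ht₁ : t₁ ∈ Ioo 0 r) :
    ∃ k : ℝ → ℝ, (∀ t ∈ Ioo 0 r, HasDerivAt k (-(p t)⁻¹) t) ∧ k t₁ = 0 ∧
      (∀ t ∈ Ioc 0 t₁, 0 ≤ k t) ∧ Tendsto k (𝓝[>] 0) atTop := by
  have hcont : ContinuousOn (fun x => (p x)⁻¹) (Ioo 0 r) :=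
    (hp.continuousOn.mono Ioo_subset_Icc_self).inv₀ fun x hx =>
      (hp.pos x (Ioo_subset_Ioc_self hx)).ne'
  have hint : ∀ t ∈ Ioo 0 r, IntervalIntegrable (fun x => (p x)⁻¹) volume t t₁ := fun t ht =>
    (hcont.mono ((ordConnected_Ioo).uIcc_subset ht ht₁)).intervalIntegrable
  obtain ⟨C, hC0, hC⟩ := hp.exists_le_linear
  refine ⟨fun t => ∫ x in t..t₁, (p x)⁻¹, fun t ht => ?_, by simp, fun t ht => ?_, ?_⟩
  · exact intervalIntegral.integral_hasDerivAt_left (hint t ht)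
      (hcont.stronglyMeasurableAtFilter isOpen_Ioo t ht)
      (hcont.continuousAt (isOpen_Ioo.mem_nhds ht))
  · exact intervalIntegral.integral_nonneg ht.2 fun x hx =>
      (inv_pos.2 (hp.pos x ⟨ht.1.trans_le hx.1, hx.2.trans ht₁.2.le⟩)).le
  · have hlog : Tendsto (fun t => C⁻¹ * (Real.log t₁ - Real.log t)) (𝓝[>] 0) atTop := by
      refine Tendsto.const_mul_atTop (inv_pos.2 hC0) ?_
      simp_rw [sub_eq_add_neg]
      exact tendsto_atTop_add_const_left _ _
        (tendsto_neg_atBot_atTop.comp Real.tendsto_log_nhdsGT_zero)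
    refine tendsto_atTop_mono' _ ?_ hlog
    filter_upwards [Ioo_mem_nhdsGT ht₁.1] with t ht
    have htr : t ∈ Ioo 0 r := ⟨ht.1, ht.2.trans ht₁.2⟩
    have hinv : ContinuousOn (fun x : ℝ => C⁻¹ * x⁻¹) (uIcc t t₁) := by
      rw [uIcc_of_le ht.2.le]
      exact continuousOn_const.mul (continuousOn_id.inv₀ fun x hx => (ht.1.trans_le hx.1).ne')
    have h := intervalIntegral.integral_mono_on (μ := volume) ht.2.le hinv.intervalIntegrable
      (hint t htr) fun x hx => by
        have hx' : x ∈ Ioc 0 r := ⟨ht.1.trans_le hx.1, hx.2.trans ht₁.2.le⟩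
        rw [← mul_inv]
        exact inv_anti₀ (hp.pos x hx') (hC x hx')
    rwa [intervalIntegral.integral_const_mul, integral_inv_of_pos ht.1 ht₁.1,
      Real.log_div ht₁.1.ne' ht.1.ne'] at h

lemma IsRadialSolution.contDiffOn {p u J : ℝ → ℝ} {r l : ℝ} (hp : IsRadialWeight p r)
    (hu : IsRadialSolution p r (fun t => -l * u t) u J) :
    ContDiffOn ℝ (⊤ : ℕ∞) u (Ioo 0 r) := by
  suffices h : ∀ n : ℕ, ContDiffOn ℝ n u (Ioo 0 r) ∧ ContDiffOn ℝ n J (Ioo 0 r) from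
    contDiffOn_infty.2 fun n => (h n).1
  have hpn : ∀ n : ℕ, ContDiffOn ℝ n p (Ioo 0 r) := contDiffOn_infty.1 hp.contDiffOn
  intro n
  induction n with
  | zero =>
    simp only [Nat.cast_zero, contDiffOn_zero]
    exact ⟨hu.continuousOn.mono Ioo_subset_Icc_self, hu.continuousOn_flux.mono Ioo_subset_Icc_self⟩
  | succ n ih =>
    push_cast
    rw [contDiffOn_succ_iff_deriv_of_isOpen isOpen_Ioo,
      contDiffOn_succ_iff_deriv_of_isOpen isOpen_Ioo]
    refine ⟨⟨fun t ht => (hu.hasDerivAt t ht).differentiableAt.differentiableWithinAt,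
      fun h => by simp at h, ?_⟩,
      ⟨fun t ht => (hu.hasDerivAt_flux t ht).differentiableAt.differentiableWithinAt,
      fun h => by simp at h, ?_⟩⟩
    · exact (ih.2.div (hpn n) fun t ht => (hp.pos t (Ioo_subset_Ioc_self ht)).ne').congr
        fun t ht => (hu.hasDerivAt t ht).deriv
    · exact ((hpn n).mul (contDiffOn_const.mul ih.1)).congr
        fun t ht => (hu.hasDerivAt_flux t ht).deriv

/-- Extending a smooth function on an open set by zero. -/
lemma contDiff_indicator {g : ℝ → ℝ} {s K : Set ℝ} (hs : IsOpen s) (hK : IsClosed K)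
    (hKs : K ⊆ s) (hg : ContDiffOn ℝ (⊤ : ℕ∞) g s) (h0 : ∀ t ∈ s \ K, g t = 0) :
    ContDiff ℝ (⊤ : ℕ∞) (s.indicator g) ∧ tsupport (s.indicator g) ⊆ K := by
  have hsupp : tsupport (s.indicator g) ⊆ K := closure_minimal (fun t ht => by
    by_contra hK'
    have hts : t ∈ s := mem_of_indicator_ne_zero ht
    exact ht (by rw [indicator_of_mem hts, h0 t ⟨hts, hK'⟩])) hK
  refine ⟨contDiff_iff_contDiffAt.2 fun t => ?_, hsupp⟩
  by_cases ht : t ∈ s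
  · refine (hg.contDiffAt (hs.mem_nhds ht)).congr_of_eventuallyEq ?_
    filter_upwards [hs.mem_nhds ht] with x hx
    exact indicator_of_mem hx g
  · exact contDiffAt_const.congr_of_eventuallyEq
      (notMem_tsupport_iff_eventuallyEq.1 fun h => ht (hKs (hsupp h)))

lemma exists_regularized_energy_nonneg {p u J k : ℝ → ℝ} {r l s t₁ δ : ℝ} (hr : 0 < r)
    (hp : IsRadialWeight p r)
    (hQ : ∀ φ, IsTestFunction r φ →
      l * ∫ t in Ioo 0 r, φ t ^ 2 * p t ≤ ∫ t in Ioo 0 r, deriv φ t ^ 2 * p t)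
    (hl : 0 < l) (hu : IsRadialSolution p r (fun t => -l * u t) u J) (ht₁ : t₁ ∈ Ioo 0 r)
    (hs : u t₁ + s < 0) (hk : ∀ t ∈ Ioo 0 r, HasDerivAt k (-(p t)⁻¹) t) (hk₁ : k t₁ = 0)
    (hktop : Tendsto k (𝓝[>] 0) atTop) (hδ : 0 < δ) :
    ∃ φ h : ℝ → ℝ, Continuous φ ∧ Continuous h ∧
      (∀ t ∈ Ioc 0 t₁, φ t = smoothPosPart 1 δ (u t + s - δ * k t)) ∧
      (∀ t ∈ Ioc 0 t₁, h t = smoothPosPart 2 δ (u t + s - δ * k t)) ∧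
      0 ≤ ∫ t in (0 : ℝ)..t₁, p t * (u t * h t - φ t ^ 2) := by
  set y : ℝ → ℝ := fun t => u t + s - δ * k t with hy
  have hsub : Ioo 0 t₁ ⊆ Ioo 0 r := Ioo_subset_Ioo_right ht₁.2.le
  have hy' : ∀ t ∈ Ioo 0 r, HasDerivAt y ((J t + δ) / p t) t := fun t ht => by
    refine (((hu.hasDerivAt t ht).add_const s).fun_sub ((hk t ht).const_mul δ)).congr_deriv ?_
    rw [add_div]
    ring
  have hyt₁ : y t₁ < 0 := by simpa [hy, hk₁] using hs
  obtain ⟨a, ha, hya⟩ : ∃ a, 0 < a ∧ ∀ t ∈ Ioo 0 a, y t < 0 := by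
    obtain ⟨B, hB⟩ := isCompact_Icc.exists_bound_of_continuousOn hu.continuousOn
    have hev : ∀ᶠ t in 𝓝[>] (0 : ℝ), y t < 0 := by
      filter_upwards [hktop.eventually_gt_atTop ((B + s) / δ), Ioo_mem_nhdsGT hr] with t h1 h2
      have h3 := (le_abs_self _).trans (hB t (Ioo_subset_Icc_self h2))
      rw [div_lt_iff₀ hδ] at h1
      simp only [hy]
      linarith
    obtain ⟨a, ha, h⟩ := mem_nhdsGT_iff_exists_Ioo_subset.1 hev
    exact ⟨a, ha, fun t ht => h ht⟩
  obtain ⟨b, hb, hyb⟩ : ∃ b, b < t₁ ∧ ∀ t ∈ Ioo b t₁, y t < 0 := by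
    have hev : ∀ᶠ t in 𝓝[<] t₁, y t < 0 :=
      ((hy' t₁ ht₁).continuousAt.eventually_lt_const hyt₁).filter_mono nhdsWithin_le_nhds
    obtain ⟨b, hb, h⟩ := mem_nhdsLT_iff_exists_Ioo_subset.1 hev
    exact ⟨b, hb, fun t ht => h ht⟩
  have hK : Icc a b ⊆ Ioo 0 t₁ := fun t ht => ⟨ha.trans_le ht.1, ht.2.trans_lt hb⟩
  have hyK : ∀ t ∈ Ioo 0 t₁ \ Icc a b, y t ≤ 0 := fun t ht => by
    by_contra! h
    refine ht.2 ⟨?_, ?_⟩ <;> by_contra! h'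
    · exact (hya t ⟨ht.1.1, h'⟩).not_gt h
    · exact (hyb t ⟨h', ht.1.2⟩).not_gt h
  have hksmooth : ContDiffOn ℝ (⊤ : ℕ∞) k (Ioo 0 r) := by
    rw [contDiffOn_infty_iff_deriv_of_isOpen isOpen_Ioo]
    exact ⟨fun t ht => (hk t ht).differentiableAt.differentiableWithinAt,
      (hp.contDiffOn.inv fun t ht => (hp.pos t (Ioo_subset_Ioc_self ht)).ne').neg.congr
        fun t ht => (hk t ht).deriv⟩
  have hysmooth : ContDiffOn ℝ (⊤ : ℕ∞) y (Ioo 0 t₁) :=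
    (((hu.contDiffOn hp).add contDiffOn_const).sub (contDiffOn_const.mul hksmooth)).mono hsub
  have hext : ∀ m : ℕ, m ≠ 0 →
      ContDiff ℝ (⊤ : ℕ∞) ((Ioo 0 t₁).indicator fun t => smoothPosPart m δ (y t)) ∧
      tsupport ((Ioo 0 t₁).indicator fun t => smoothPosPart m δ (y t)) ⊆ Icc a b := fun m hm =>
    contDiff_indicator isOpen_Ioo isClosed_Icc hK
      ((contDiff_smoothPosPart m δ).comp_contDiffOn hysmooth)
      fun t ht => smoothPosPart_of_nonpos hm hδ (hyK t ht)
  set φ := (Ioo 0 t₁).indicator fun t => smoothPosPart 1 δ (y t) with hφ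
  set h := (Ioo 0 t₁).indicator fun t => smoothPosPart 2 δ (y t) with hh
  obtain ⟨hφs, hφK⟩ := hext 1 one_ne_zero
  obtain ⟨hhs, hhK⟩ := hext 2 two_ne_zero
  rw [← hφ] at hφs hφK
  rw [← hh] at hhs hhK
  have hind : ∀ m : ℕ, m ≠ 0 → ∀ t ∈ Ioc 0 t₁,
      (Ioo 0 t₁).indicator (fun t => smoothPosPart m δ (y t)) t = smoothPosPart m δ (y t) :=
    fun m hm t ht => by
      rcases ht.2.lt_or_eq with hlt | rfl
      · exact indicator_of_mem (show t ∈ Ioo 0 t₁ from ⟨ht.1, hlt⟩) _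
      · rw [indicator_of_notMem (by simp), smoothPosPart_of_nonpos hm hδ hyt₁.le]
  have hφc : Continuous (deriv φ) := hφs.continuous_deriv (by simp)
  refine ⟨φ, h, hφs.continuous, hhs.continuous, hind 1 one_ne_zero, hind 2 two_ne_zero, ?_⟩
  have hoff : ∀ {f : ℝ → ℝ}, tsupport f ⊆ Icc a b → ∀ t, t ∉ Ioo 0 t₁ → f =ᶠ[𝓝 t] 0 :=
    fun hf t ht => notMem_tsupport_iff_eventuallyEq.1 fun h => ht (hK (hf h))
  have hder : ∀ t ∈ Ioo 0 r, HasDerivAt (fun t => h t * (J t + δ))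
      (deriv φ t ^ 2 * p t - l * (p t * (u t * h t))) t := fun t ht => by
    by_cases htt : t ∈ Ioo 0 t₁
    · have hev : ∀ m : ℕ, (Ioo 0 t₁).indicator (fun t => smoothPosPart m δ (y t)) =ᶠ[𝓝 t]
          fun t => smoothPosPart m δ (y t) := fun m => by
        filter_upwards [isOpen_Ioo.mem_nhds htt] with x hx using indicator_of_mem hx _
      have hder' : ∀ m : ℕ, HasDerivAt ((Ioo 0 t₁).indicator fun t => smoothPosPart m δ (y t))
          (Real.smoothTransition (y t / δ) ^ m * ((J t + δ) / p t)) t := fun m =>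
        ((hasDerivAt_smoothPosPart m δ (y t)).comp t (hy' t ht)).congr_of_eventuallyEq (hev m)
      have hpt := hp.pos t (Ioo_subset_Ioc_self ht)
      refine ((hder' 2).fun_mul ((hu.hasDerivAt_flux t ht).add_const δ)).congr_deriv ?_
      rw [(hder' 1).deriv, hh]
      field_simp
      ring
    · have h1 := hoff hφK t htt
      have h2 := hoff hhK t htt
      have h3 : (fun t => h t * (J t + δ)) =ᶠ[𝓝 t] fun _ => 0 := by
        filter_upwards [h2] with x hx
        simp [hx]
      refine ((hasDerivAt_const t (0 : ℝ)).congr_of_eventuallyEq h3).congr_deriv ?_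
      rw [h1.deriv_eq, h2.self_of_nhds]
      simp
  have hIcc : Icc 0 t₁ ⊆ Icc 0 r := Icc_subset_Icc_right ht₁.2.le
  have hpc := hp.continuousOn.mono hIcc
  have huc := hu.continuousOn.mono hIcc
  have hint : ∀ {f : ℝ → ℝ}, ContinuousOn f (Icc 0 t₁) → IntervalIntegrable f volume 0 t₁ :=
    fun hf => intervalIntegrable_of_continuousOn_Icc hf (left_mem_Icc.2 ht₁.1.le)
      (right_mem_Icc.2 ht₁.1.le)
  have he : ContinuousOn (fun t => deriv φ t ^ 2 * p t) (Icc 0 t₁) :=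
    (hφc.pow 2).continuousOn.mul hpc
  have hm : ContinuousOn (fun t => φ t ^ 2 * p t) (Icc 0 t₁) :=
    (hφs.continuous.pow 2).continuousOn.mul hpc
  have hpuh : ContinuousOn (fun t => p t * (u t * h t)) (Icc 0 t₁) :=
    hpc.mul (huc.mul hhs.continuous.continuousOn)
  have hlpuh : ContinuousOn (fun t => l * (p t * (u t * h t))) (Icc 0 t₁) :=
    continuousOn_const.mul hpuh
  have hftc := intervalIntegral.integral_eq_sub_of_hasDerivAt_of_le ht₁.1.le
    (hhs.continuous.continuousOn.mul
      ((hu.continuousOn_flux.mono hIcc).add continuousOn_const))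
    (fun t ht => hder t (hsub ht)) (hint (he.sub hlpuh))
  have hh0 : h 0 = 0 := (hoff hhK 0 (by simp)).self_of_nhds
  have hh1 : h t₁ = 0 := (hoff hhK t₁ (by simp)).self_of_nhds
  rw [intervalIntegral.integral_sub (hint he) (hint hlpuh),
    intervalIntegral.integral_const_mul] at hftc
  simp only [Pi.mul_apply, hh0, hh1, zero_mul, sub_zero] at hftc
  have hle : l * ∫ t in (0 : ℝ)..t₁, φ t ^ 2 * p t ≤ ∫ t in (0 : ℝ)..t₁, deriv φ t ^ 2 * p t := by
    by_cases hφ0 : φ = 0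
    · rw [hφ0]
      simp
    · have hset : ∀ {f : ℝ → ℝ}, (∀ t, t ∉ Ioo 0 t₁ → f t = 0) →
          ∫ t in Ioo 0 r, f t = ∫ t in (0 : ℝ)..t₁, f t := fun hf => by
        rw [← setIntegral_Ioo_eq_intervalIntegral ht₁.1.le]
        exact setIntegral_eq_of_subset_of_forall_sdiff_eq_zero measurableSet_Ioo hsub
          fun t ht => hf t ht.2
      have hφt : IsTestFunction r φ :=
        ⟨hφs, isCompact_Icc.of_isClosed_subset (isClosed_tsupport φ) hφK,
          hφK.trans (hK.trans hsub), hφ0⟩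
      have := hQ φ hφt
      rwa [hset fun t ht => by simp [(hoff hφK t ht).self_of_nhds],
        hset fun t ht => by simp [(hoff hφK t ht).deriv_eq]] at this
  have hrew : ∫ t in (0 : ℝ)..t₁, p t * (u t * h t - φ t ^ 2) =
      (∫ t in (0 : ℝ)..t₁, p t * (u t * h t)) - ∫ t in (0 : ℝ)..t₁, φ t ^ 2 * p t := by
    rw [← intervalIntegral.integral_sub (hint hpuh) (hint hm)]
    congr 1
    ext t
    ring
  rw [hrew]
  have : 0 ≤ l * ((∫ t in (0 : ℝ)..t₁, p t * (u t * h t)) -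
      ∫ t in (0 : ℝ)..t₁, φ t ^ 2 * p t) := by linarith
  exact nonneg_of_mul_nonneg_right this hl

/-- If the Rayleigh quotient is bounded below by `l`, the regular eigensolution for `l` has no zero
inside the interval. -/
lemma eigenSolution_pos_of_mul_mass_le_energy {p u J : ℝ → ℝ} {r l : ℝ} (hr : 0 < r)
    (hp : IsRadialWeight p r)
    (hQ : ∀ φ, IsTestFunction r φ →
      l * ∫ t in Ioo 0 r, φ t ^ 2 * p t ≤ ∫ t in Ioo 0 r, deriv φ t ^ 2 * p t)
    (hl : 0 < l) (hu : IsRadialSolution p r (fun t => -l * u t) u J) (hu0 : u 0 = 1) :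
    ∀ t ∈ Ico 0 r, 0 < u t := by
  by_contra! hcon
  obtain ⟨c, hc, huc⟩ := hcon
  have hclosed : IsClosed {t ∈ Icc 0 r | u t ≤ 0} :=
    hu.continuousOn.preimage_isClosed_of_isClosed isClosed_Icc isClosed_Iic
  obtain ⟨t₀, ⟨ht₀, hut₀⟩, hmin⟩ := (isCompact_Icc.of_isClosed_subset hclosed
    fun t ht => ht.1).exists_isLeast ⟨c, Ico_subset_Icc_self hc, huc⟩
  have ht₀0 : 0 < t₀ := ht₀.1.lt_of_ne fun h => by rw [← h, hu0] at hut₀; norm_num at hut₀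
  have ht₀r : t₀ < r := (hmin ⟨Ico_subset_Icc_self hc, huc⟩).trans_lt hc.2
  have hupos : ∀ x ∈ Ioo 0 t₀, 0 < u x := fun x hx => by
    by_contra! h
    exact (hmin ⟨⟨hx.1.le, hx.2.le.trans ht₀.2⟩, h⟩).not_gt hx.2
  have hJ₀ : J t₀ < 0 := hu.flux_neg hp hl ⟨ht₀0, ht₀.2⟩ hupos
  obtain ⟨t₁, ht₁, hut₁⟩ : ∃ t₁ ∈ Ioo 0 r, u t₁ < 0 := by
    have hev : ∀ᶠ t in 𝓝[>] t₀, J t < 0 :=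
      (((hu.continuousOn_flux.continuousAt (Icc_mem_nhds ht₀0 ht₀r)).eventually_lt_const
        hJ₀)).filter_mono nhdsWithin_le_nhds
    obtain ⟨t₁, ht₁, h⟩ := mem_nhdsGT_iff_exists_Ioc_subset.1
      (hev.and (Ioo_mem_nhdsGT ht₀r))
    have htr : t₁ < r := (h ⟨ht₁, le_rfl⟩).2.2
    refine ⟨t₁, ⟨ht₀0.trans ht₁, htr⟩, ?_⟩
    have hsub : Ioo t₀ t₁ ⊆ Ioo 0 r := Ioo_subset_Ioo ht₀0.le htr.le
    have := strictAntiOn_Icc_of_hasDerivAt_neg (hu.continuousOn.mono (Icc_subset_Icc ht₀0.le htr.le))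
      (fun t ht => hu.hasDerivAt t (hsub ht)) (fun t ht => div_neg_of_neg_of_pos
        (h (Ioo_subset_Ioc_self ht)).1 (hp.pos t (Ioo_subset_Ioc_self (hsub ht))))
      (left_mem_Icc.2 (le_of_lt ht₁)) (right_mem_Icc.2 (le_of_lt ht₁)) ht₁
    linarith
  have hIcc : Icc 0 t₁ ⊆ Icc 0 r := Icc_subset_Icc_right ht₁.2.le
  set s : ℝ := -u t₁ / 2 with hs
  have hs0 : 0 < s := by rw [hs]; linarith
  obtain ⟨k, hk, hk₁, hk0, hktop⟩ := hp.exists_singularSolution ht₁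
  have hδ : ∀ n : ℕ, 0 < 1 / ((n : ℝ) + 1) := fun n => Nat.one_div_pos_of_nat
  choose φ h hφc hhc hφ hh hnonneg using fun n : ℕ => exists_regularized_energy_nonneg hr hp hQ hl
    hu ht₁ (s := s) (by rw [hs]; linarith) hk hk₁ hktop (hδ n)
  obtain ⟨B, hB⟩ := isCompact_Icc.exists_bound_of_continuousOn hu.continuousOn
  have hB0 : 0 ≤ B := (norm_nonneg _).trans (hB t₀ ht₀)
  obtain ⟨P, hP⟩ := isCompact_Icc.exists_bound_of_continuousOn hp.continuousOn
  have hpc := hp.continuousOn.mono hIcc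
  have huc' := hu.continuousOn.mono hIcc
  set g : ℝ → ℝ := fun t => max (u t + s) 0 with hg
  have hgc : ContinuousOn g (Icc 0 t₁) := (huc'.add continuousOn_const).sup continuousOn_const
  have hlim : Tendsto (fun n => ∫ t in (0 : ℝ)..t₁, p t * (u t * h n t - φ n t ^ 2)) atTop
      (𝓝 (∫ t in (0 : ℝ)..t₁, p t * (u t * g t - g t ^ 2))) := by
    refine intervalIntegral.tendsto_integral_filter_of_dominated_convergence
      (fun _ => P * (B * (B + s) + (B + s) ^ 2)) (Eventually.of_forall fun n => ?_)
      (Eventually.of_forall fun n => ae_of_all _ fun t ht => ?_)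
      intervalIntegrable_const (ae_of_all _ fun t ht => ?_)
    · rw [uIoc_of_le ht₁.1.le]
      exact ((hpc.mul ((huc'.mul (hhc n).continuousOn).sub
        ((hφc n).pow 2).continuousOn)).mono Ioc_subset_Icc_self).aestronglyMeasurable
        measurableSet_Ioc
    · rw [uIoc_of_le ht₁.1.le] at ht
      have htr := hIcc (Ioc_subset_Icc_self ht)
      have hbd : ∀ m : ℕ, m ≠ 0 →
          |smoothPosPart m (1 / ((n : ℝ) + 1)) (u t + s - 1 / ((n : ℝ) + 1) * k t)| ≤ B + s :=
        fun m hm => by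
          rw [abs_of_nonneg (smoothPosPart_nonneg hm (hδ n))]
          refine (smoothPosPart_le hm (hδ n)).trans (max_le ?_ (by positivity))
          have h1 := (le_abs_self _).trans (hB t htr)
          have h2 := mul_nonneg (hδ n).le (hk0 t ht)
          linarith
      rw [hφ n t ht, hh n t ht, norm_mul]
      have h1 := hbd 1 one_ne_zero
      have h2 := hbd 2 two_ne_zero
      refine mul_le_mul (hP t htr) ((norm_sub_le _ _).trans ?_) (norm_nonneg _)
        ((norm_nonneg _).trans (hP t htr))
      rw [norm_mul, norm_pow]
      exact add_le_add (mul_le_mul (hB t htr) h2 (norm_nonneg _) hB0)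
        (pow_le_pow_left₀ (norm_nonneg _) h1 2)
    · rw [uIoc_of_le ht₁.1.le] at ht
      have hδlim := tendsto_one_div_add_atTop_nhds_zero_nat (𝕜 := ℝ)
      have hy : Tendsto (fun n : ℕ => max (u t + s - 1 / ((n : ℝ) + 1) * k t) 0) atTop
          (𝓝 (g t)) := by
        have := (tendsto_const_nhds (x := u t + s)).sub (hδlim.mul_const (k t))
        rw [zero_mul, sub_zero] at this
        exact this.max tendsto_const_nhds
      have hposlim : ∀ m : ℕ, m ≠ 0 → Tendsto (fun n : ℕ => smoothPosPart m (1 / ((n : ℝ) + 1))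
          (u t + s - 1 / ((n : ℝ) + 1) * k t)) atTop (𝓝 (g t)) := fun m hm => by
        have hlow := hy.sub hδlim
        rw [sub_zero] at hlow
        exact tendsto_of_tendsto_of_tendsto_of_le_of_le hlow hy
          (fun n => sub_le_smoothPosPart hm (hδ n)) fun n => smoothPosPart_le hm (hδ n)
      simp_rw [hφ _ t ht, hh _ t ht]
      exact (((hposlim 2 two_ne_zero).const_mul _).sub ((hposlim 1 one_ne_zero).pow 2)).const_mul _
  have hge : 0 ≤ ∫ t in (0 : ℝ)..t₁, p t * (u t * g t - g t ^ 2) := ge_of_tendsto' hlim hnonneg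
  have hid : ∀ t, u t * g t - g t ^ 2 = -(s * g t) := fun t => by
    rcases le_total (u t + s) 0 with h1 | h1
    · simp [hg, max_eq_right h1]
    · simp only [hg, max_eq_left h1]
      ring
  have hpos : 0 < ∫ t in (0 : ℝ)..t₁, p t * (s * g t) := by
    have ht₀₁ : t₀ / 2 < t₁ := by
      by_contra! h1
      exact (hupos t₁ ⟨ht₁.1, by linarith⟩).not_gt hut₁
    refine intervalIntegral.integral_pos ht₁.1 (hpc.mul (continuousOn_const.mul hgc))
      (fun t ht => ?_) ⟨t₀ / 2, ⟨by positivity, ht₀₁.le⟩, ?_⟩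
    · exact mul_nonneg (hp.pos t ⟨ht.1, ht.2.trans ht₁.2.le⟩).le
        (mul_nonneg hs0.le (le_max_right _ _))
    · have h1 := hupos (t₀ / 2) ⟨by positivity, by linarith⟩
      exact mul_pos (hp.pos _ ⟨by positivity, by linarith⟩)
        (mul_pos hs0 ((add_pos h1 hs0).trans_le (le_max_left _ _)))
  simp_rw [hid, mul_neg, intervalIntegral.integral_neg] at hge
  linarith

/-- The profile of a rotationally symmetric metric `dt² + a(t)² dθ²` on the ball of radius `r`. -/
structure IsProfile (a : ℝ → ℝ) (r : ℝ) : Prop where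
  contDiffOn : ContDiffOn ℝ (⊤ : ℕ∞) a (Icc 0 r)
  zero : a 0 = 0
  derivWithin_zero : derivWithin a (Icc 0 r) 0 = 1
  pos : ∀ t ∈ Ioc 0 r, 0 < a t

/-- The continuous extension of `a t / t` by `1` at `t = 0`. -/
noncomputable def profileRatio (a : ℝ → ℝ) : ℝ → ℝ := Function.update (fun t => a t / t) 0 1

lemma mul_profileRatio {a : ℝ → ℝ} (h0 : a 0 = 0) (t : ℝ) : t * profileRatio a t = a t := by
  rcases eq_or_ne t 0 with rfl | ht
  · simp [h0]
  · rw [profileRatio, Function.update_of_ne ht]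
    field_simp

lemma IsProfile.continuousOn_profileRatio {a : ℝ → ℝ} {r : ℝ} (ha : IsProfile a r) :
    ContinuousOn (profileRatio a) (Icc 0 r) := by
  intro t ht
  rcases eq_or_ne t 0 with rfl | ht0
  · rw [profileRatio, continuousWithinAt_update_same]
    have h := ((ha.contDiffOn.differentiableOn (by simp)) 0 ht).hasDerivWithinAt
    rw [ha.derivWithin_zero, hasDerivWithinAt_iff_tendsto_slope] at h
    refine h.congr fun x => ?_
    simp [slope_def_field, ha.zero]
  · rw [profileRatio, continuousWithinAt_update_of_ne ht0]
    exact (ha.contDiffOn.continuousOn t ht).div continuousWithinAt_id ht0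

lemma IsProfile.profileRatio_pos {a : ℝ → ℝ} {r t : ℝ} (ha : IsProfile a r) (ht : t ∈ Icc 0 r) :
    0 < profileRatio a t := by
  rcases ht.1.eq_or_lt with rfl | h0
  · simp [profileRatio]
  · rw [profileRatio, Function.update_of_ne h0.ne']
    exact div_pos (ha.pos t ⟨h0, ht.2⟩) h0

lemma IsProfile.isRadialWeight_pow {a : ℝ → ℝ} {r : ℝ} (hr : 0 < r) (ha : IsProfile a r) {m : ℕ}
    (hm : m ≠ 0) : IsRadialWeight (fun t => a t ^ m) r := by
  have hcont := ha.continuousOn_profileRatio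
  have hne : (Icc 0 r).Nonempty := ⟨0, left_mem_Icc.2 hr.le⟩
  obtain ⟨x₀, hx₀, hmin⟩ := isCompact_Icc.exists_isMinOn hne hcont
  obtain ⟨x₁, hx₁, hmax⟩ := isCompact_Icc.exists_isMaxOn hne hcont
  set c := profileRatio a x₀
  set C := profileRatio a x₁
  have hc : 0 < c := ha.profileRatio_pos hx₀
  have hC : 0 < C := ha.profileRatio_pos hx₁
  have hupper : ∀ t ∈ Ioc 0 r, a t ≤ C * t := fun t ht => by
    rw [← mul_profileRatio ha.zero, mul_comm]
    exact mul_le_mul_of_nonneg_right (hmax (Ioc_subset_Icc_self ht)) ht.1.le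
  have hlower : ∀ t ∈ Ioc 0 r, c * t ≤ a t := fun t ht => by
    rw [← mul_profileRatio ha.zero t, mul_comm]
    exact mul_le_mul_of_nonneg_left (hmin (Ioc_subset_Icc_self ht)) ht.1.le
  refine ⟨ha.contDiffOn.continuousOn.pow m, (ha.contDiffOn.mono Ioo_subset_Icc_self).pow m,
    fun t ht => pow_pos (ha.pos t ht) m, ⟨(C / c) ^ m, by positivity, fun x s hx hxs hs => ?_⟩,
    ⟨C ^ m * r ^ (m - 1), by positivity, fun t ht => ?_⟩⟩
  · rw [← mul_pow]
    refine pow_le_pow_left₀ (ha.pos x ⟨hx, hxs.trans hs⟩).le ?_ m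
    calc a x ≤ C * x := hupper x ⟨hx, hxs.trans hs⟩
      _ ≤ C * s := by gcongr
      _ = C / c * (c * s) := by field_simp
      _ ≤ C / c * a s := by
        have := hlower s ⟨hx.trans_le hxs, hs⟩
        gcongr
  · obtain ⟨j, rfl⟩ := Nat.exists_eq_succ_of_ne_zero hm
    have ht0 := ht.1.le
    calc a t ^ (j + 1) ≤ (C * t) ^ (j + 1) :=
          pow_le_pow_left₀ (ha.pos t ht).le (hupper t ht) _
      _ = C ^ (j + 1) * t ^ j * t := by ring
      _ ≤ C ^ (j + 1) * r ^ j * t := by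
        have := ht.2
        gcongr

lemma IsProfile.hasDerivAt {a : ℝ → ℝ} {r t : ℝ} (ha : IsProfile a r) (ht : t ∈ Ioo 0 r) :
    HasDerivAt a (derivWithin a (Icc 0 r) t) t :=
  ((ha.contDiffOn.differentiableOn (by simp)) t (Ioo_subset_Icc_self ht)).hasDerivWithinAt.hasDerivAt
    (Icc_mem_nhds ht.1 ht.2)

/-- Equality of the fundamental tones forces equality of two profiles with ordered logarithmic
derivatives. -/
lemma IsProfile.eqOn_of_mu_eq {n : ℕ} (hn : 2 ≤ n) {a b : ℝ → ℝ} {r : ℝ} (hr : 0 < r)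
    (ha : IsProfile a r) (hb : IsProfile b r)
    (hab : ∀ t ∈ Ioo 0 r,
      derivWithin b (Icc 0 r) t / b t ≤ derivWithin a (Icc 0 r) t / a t)
    (hmu : mu n a (Ioo 0 r) = mu n b (Ioo 0 r)) : EqOn a b (Icc 0 r) := by
  have hm : n - 1 ≠ 0 := by omega
  have hq := ha.isRadialWeight_pow hr hm
  have hp := hb.isRadialWeight_pow hr hm
  set l := mu n a (Ioo 0 r) with hl_def
  have hl : 0 < l := lt_mu_of_eigenSolution_pos (v := fun _ => 1) (K := fun _ => 0) hr hq le_rfl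
    ⟨continuousOn_const, continuousOn_const, rfl,
      fun t _ => by simpa using hasDerivAt_const t (1 : ℝ),
      fun t _ => by simpa using hasDerivAt_const t (0 : ℝ)⟩ fun _ _ => one_pos
  obtain ⟨u, J, hu0, hu⟩ := hp.exists_eigenSolution hr l
  obtain ⟨v, K, hv0, hv⟩ := hq.exists_eigenSolution hr l
  have hupos := eigenSolution_pos_of_mul_mass_le_energy hr hp
    (fun φ hφ => hmu ▸ mu_mul_le hr hp hφ) hl hu hu0
  set R : ℝ → ℝ := fun t => (profileRatio a t / profileRatio b t) ^ (n - 1) with hR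
  have hRc : ContinuousOn R (Icc 0 r) := ((ha.continuousOn_profileRatio).div
    (hb.continuousOn_profileRatio) fun t ht => (hb.profileRatio_pos ht).ne').pow _
  have hRab : ∀ t, t ≠ 0 → R t = (a t / b t) ^ (n - 1) := fun t ht => by
    simp only [hR, profileRatio, Function.update_of_ne ht]
    rw [div_div_div_cancel_right₀ ht]
  set R' : ℝ → ℝ := fun t => ((n - 1 : ℕ) : ℝ) * (a t / b t) ^ (n - 1 - 1) *
    ((derivWithin a (Icc 0 r) t * b t - a t * derivWithin b (Icc 0 r) t) / b t ^ 2)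
  have hRder : ∀ t ∈ Ioo 0 r, HasDerivAt R (R' t) t := fun t ht => by
    have hbt := hb.pos t (Ioo_subset_Ioc_self ht)
    refine (((ha.hasDerivAt ht).fun_div (hb.hasDerivAt ht) hbt.ne').fun_pow
      (n - 1)).congr_of_eventuallyEq ?_
    filter_upwards [isOpen_Ioo.mem_nhds ht] with x hx using hRab x hx.1.ne'
  have hR'nonneg : ∀ t ∈ Ioo 0 r, 0 ≤ R' t := fun t ht => by
    have hat := ha.pos t (Ioo_subset_Ioc_self ht)
    have hbt := hb.pos t (Ioo_subset_Ioc_self ht)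
    have h := hab t ht
    rw [div_le_div_iff₀ hbt hat] at h
    have h' : 0 ≤ derivWithin a (Icc 0 r) t * b t - a t * derivWithin b (Icc 0 r) t := by linarith
    positivity
  rcases eigenSolution_pos_or_ratio_constant hl hp hq hRc hRder hR'nonneg (fun t ht => by
      have hbt := hb.pos t ht
      rw [hRab t ht.1.ne', ← mul_pow, div_mul_cancel₀ _ hbt.ne']) hu hv hv0 hupos with hpos | hzero
  · exact absurd (lt_mu_of_eigenSolution_pos hr hq hl.le hv hpos) (lt_irrefl _)
  · intro t ht
    have h0 : (0 : ℝ) ∈ Icc 0 r := left_mem_Icc.2 hr.le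
    have hR0 : R 0 = 1 := by simp [hR, profileRatio]
    have h1 := monotoneOn_Icc_of_hasDerivAt_nonneg hRc hRder hR'nonneg h0 ht ht.1
    have h2 := monotoneOn_Icc_of_hasDerivAt_nonneg hRc.neg (fun x hx => (hRder x hx).neg)
      (fun x hx => by simp [hzero x hx]) h0 ht ht.1
    simp only [Pi.neg_apply, neg_le_neg_iff] at h2
    have h3 : R t = 1 := le_antisymm (h2.trans hR0.le) (hR0.ge.trans h1)
    have hat := ha.profileRatio_pos ht
    have hbt := hb.profileRatio_pos ht
    rw [hR, pow_eq_one_iff_of_nonneg (by positivity) hm, div_eq_one_iff_eq hbt.ne'] at h3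
    rw [← mul_profileRatio ha.zero, ← mul_profileRatio hb.zero, h3]

lemma contDiff_Sk (κ : ℝ) : ContDiff ℝ (⊤ : ℕ∞) (Sk κ) := by
  unfold Sk
  split_ifs
  · exact (Real.contDiff_sinh.comp (contDiff_const.mul contDiff_id)).div_const _
  · exact contDiff_id
  · exact (Real.contDiff_sin.comp (contDiff_const.mul contDiff_id)).div_const _

lemma Sk_zero (κ : ℝ) : Sk κ 0 = 0 := by
  unfold Sk
  split_ifs <;> simp

lemma hasDerivAt_Sk_zero (κ : ℝ) : HasDerivAt (Sk κ) 1 0 := by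
  unfold Sk
  split_ifs with h1 h2
  · have hs : 0 < Real.sqrt (-κ) := Real.sqrt_pos.2 (neg_pos.2 h1)
    have h := (((hasDerivAt_id (0 : ℝ)).const_mul (Real.sqrt (-κ))).sinh).div_const
      (Real.sqrt (-κ))
    refine h.congr_deriv ?_
    simp [hs.ne']
  · exact hasDerivAt_id _
  · have hs : 0 < Real.sqrt κ := Real.sqrt_pos.2 ((not_lt.1 h1).lt_of_ne' h2)
    have h := (((hasDerivAt_id (0 : ℝ)).const_mul (Real.sqrt κ)).sin).div_const (Real.sqrt κ)
    refine h.congr_deriv ?_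
    simp [hs.ne']

lemma Sk_pos {κ t : ℝ} (ht : 0 < t) (hκ : 0 < κ → t < Real.pi / Real.sqrt κ) : 0 < Sk κ t := by
  unfold Sk
  split_ifs with h1 h2
  · have hs : 0 < Real.sqrt (-κ) := Real.sqrt_pos.2 (neg_pos.2 h1)
    exact div_pos (Real.sinh_pos_iff.2 (mul_pos hs ht)) hs
  · exact ht
  · have hκ0 : 0 < κ := (not_lt.1 h1).lt_of_ne' h2
    have hs : 0 < Real.sqrt κ := Real.sqrt_pos.2 hκ0
    refine div_pos (Real.sin_pos_of_pos_of_lt_pi (mul_pos hs ht) ?_) hs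
    have := (lt_div_iff₀ hs).1 (hκ hκ0)
    linarith

lemma isProfile_Sk {κ r : ℝ} (hr : 0 < r) (hrκ : 0 < κ → r < Real.pi / Real.sqrt κ) :
    IsProfile (Sk κ) r :=
  ⟨(contDiff_Sk κ).contDiffOn, Sk_zero κ, (hasDerivAt_Sk_zero κ).hasDerivWithinAt.derivWithin
    (uniqueDiffOn_Icc hr 0 (left_mem_Icc.2 hr.le)),
    fun _ ht => Sk_pos ht.1 fun hκ => ht.2.trans_lt (hrκ hκ)⟩

/-- rigidity in Theorem 1.1 together with Remark 4.2, rotationally symmetric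
case: under the hypotheses of Theorem 1.1, if `μ_n(f, r) = μ_n(S_κ, r)` then
`f = S_κ` on `[0, r]`. -/
theorem stmt6 (n : ℕ) (hn : 2 ≤ n) (κ : ℝ) (r : ℝ) (hr : 0 < r)
    (hrκ : 0 < κ → r < Real.pi / Real.sqrt κ)
    (f : ℝ → ℝ) (hf : ContDiffOn ℝ (⊤ : ℕ∞) f (Set.Icc 0 r)) (hf0 : f 0 = 0)
    (hf'0 : derivWithin f (Set.Icc 0 r) 0 = 1) (hfpos : ∀ t ∈ Set.Ioc 0 r, 0 < f t)
    (hcomp :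
      (∀ t ∈ Set.Ioo 0 r, deriv (Sk κ) t / Sk κ t ≤ derivWithin f (Set.Icc 0 r) t / f t) ∨
      (∀ t ∈ Set.Ioo 0 r, derivWithin f (Set.Icc 0 r) t / f t ≤ deriv (Sk κ) t / Sk κ t))
    (heq : mu n f (Set.Ioo 0 r) = mu n (Sk κ) (Set.Ioo 0 r)) :
    ∀ t ∈ Set.Icc 0 r, f t = Sk κ t := by
  have hF : IsProfile f r := ⟨hf, hf0, hf'0, hfpos⟩
  have hS := isProfile_Sk hr hrκ
  have hder : ∀ t ∈ Set.Ioo 0 r, deriv (Sk κ) t = derivWithin (Sk κ) (Set.Icc 0 r) t :=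
    fun t ht => (hS.hasDerivAt ht).deriv
  rcases hcomp with h | h
  · exact hF.eqOn_of_mu_eq hn hr hS (fun t ht => hder t ht ▸ h t ht) heq
  · exact fun t ht =>
      (hS.eqOn_of_mu_eq hn hr hF (fun t ht => hder t ht ▸ h t ht) heq.symm ht).symm
end
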